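/- arXiv:1504.06020 — 3 statements merged into one kernel-verified Lean document; each statement's English description precedes it below -/
import Mathlib

section
/- Let D ∈ ℝ^{N×N} be the matrix D = αG + 2(I − Z_d), where G is block diagonal with symmetric p×p blocks G_ii satisfying G_ii ⪰ mI (m > 0, α > 0), Z = W ⊗ I_p for a symmetric row-stochastic matrix W with nonnegative entries whose diagonal entries satisfy 0 ≤ δ ≤ W_ii ≤ Δ < 1, Z_d is the block diagonal part of Z, and B = I − 2Z_d + Z. Then D is positive definite and the matrix D^{-1/2} B D^{-1/2} is positive semidefinite with all eigenvalues bounded above by ρ := 2(1−δ)/(2(1−δ)+αm) < 1; that is, 0 ⪯ D^{-1/2} B D^{-1/2} ⪯ ρ I. -/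
set_option autoImplicit false

open Matrix
open scoped Kronecker

/-- A real symmetric diagonally dominant matrix with nonnegative diagonal is positive
semidefinite. -/
theorem posSemidef_of_sum_abs_le_diag {ι : Type*} [Fintype ι] [DecidableEq ι]
    {A : Matrix ι ι ℝ} (hA : A.IsSymm)
    (h : ∀ i, ∑ j ∈ Finset.univ.erase i, |A i j| ≤ A i i) : A.PosSemidef := by
  have hH : A.IsHermitian := by rwa [Matrix.IsHermitian, conjTranspose_eq_transpose_of_trivial]
  rw [hH.posSemidef_iff_eigenvalues_nonneg]
  intro k
  have hev : Module.End.HasEigenvalue (Matrix.toLin' A) (hH.eigenvalues k) := by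
    rw [Module.End.hasEigenvalue_iff_mem_spectrum, Matrix.spectrum_toLin']
    exact hH.eigenvalues_mem_spectrum_real k
  obtain ⟨i, hi⟩ := eigenvalue_mem_ball hev
  rw [Metric.mem_closedBall, Real.dist_eq, abs_le] at hi
  simp only [Real.norm_eq_abs] at hi
  have := h i
  simp only [Pi.zero_apply]
  linarith [hi.1]

theorem PosSemidef.blockDiagonal {ι κ : Type*} [Fintype ι] [DecidableEq ι] [Fintype κ]
    [DecidableEq κ] {M : κ → Matrix ι ι ℝ} (hM : ∀ k, (M k).PosSemidef) :
    (Matrix.blockDiagonal M).PosSemidef := by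
  refine .of_dotProduct_mulVec_nonneg ?_ fun x => ?_
  · rw [Matrix.IsHermitian, blockDiagonal_conjTranspose]
    exact congrArg _ (funext fun k => (hM k).isHermitian)
  · have hsum : star x ⬝ᵥ (Matrix.blockDiagonal M *ᵥ x) =
        ∑ k, star (fun i => x (i, k)) ⬝ᵥ (M k *ᵥ fun i => x (i, k)) := by
      simp only [dotProduct, mulVec, Fintype.sum_prod_type, blockDiagonal_apply, ite_mul, zero_mul,
        Finset.sum_ite_eq, Finset.mem_univ, if_true, Pi.star_apply]
      exact Finset.sum_comm
    rw [hsum]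
    exact Finset.sum_nonneg fun k _ => (hM k).dotProduct_mulVec_nonneg _

/-- With `D = αG + 2(I − Z_d)` where `G` is block diagonal with symmetric blocks
`G_ii ⪰ mI` (`m > 0`, `α > 0`), `Z = W ⊗ I_p` for a symmetric row-stochastic nonnegative `W`
with `0 ≤ δ ≤ W_ii ≤ Δ < 1`, `Z_d` the block diagonal part of `Z`, and `B = I − 2Z_d + Z`:
`D` is positive definite and `0 ⪯ D^{-1/2} B D^{-1/2} ⪯ ρ I` with
`ρ = 2(1−δ)/(2(1−δ)+αm) < 1`, where `D^{-1/2}` is the inverse of the positive square root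
of `D`. -/
theorem stmt_0 {n p : ℕ} (hn : 1 ≤ n) (hp : 1 ≤ p)
    (δ Δ m α : ℝ) (hδ0 : 0 ≤ δ) (hδΔ : δ ≤ Δ) (hΔ1 : Δ < 1) (hm : 0 < m) (hα : 0 < α)
    (W : Matrix (Fin n) (Fin n) ℝ)
    (hWsymm : W.IsSymm)
    (hWnonneg : ∀ i j, 0 ≤ W i j)
    (hWrow : ∀ i, ∑ j, W i j = 1)
    (hWdiag : ∀ i, δ ≤ W i i ∧ W i i ≤ Δ)
    (Gblk : Fin n → Matrix (Fin p) (Fin p) ℝ)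
    (hGsymm : ∀ i, (Gblk i).IsSymm)
    (hGlb : ∀ i, (Gblk i - m • (1 : Matrix (Fin p) (Fin p) ℝ)).PosSemidef)
    (G Z Zd B D : Matrix (Fin n × Fin p) (Fin n × Fin p) ℝ)
    (hG : G = Matrix.of fun q r => if q.1 = r.1 then Gblk q.1 q.2 r.2 else 0)
    (hZ : Z = W ⊗ₖ (1 : Matrix (Fin p) (Fin p) ℝ))
    (hZd : Zd = Matrix.of fun q r => if q.1 = r.1 then Z q r else 0)
    (hB : B = 1 - (2 : ℝ) • Zd + Z)
    (hD : D = α • G + (2 : ℝ) • (1 - Zd)) :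
    D.PosDef ∧
    2 * (1 - δ) / (2 * (1 - δ) + α * m) < 1 ∧
    ∀ S : Matrix (Fin n × Fin p) (Fin n × Fin p) ℝ, S.PosDef → S * S = D →
      (S⁻¹ * B * S⁻¹).PosSemidef ∧
      ((2 * (1 - δ) / (2 * (1 - δ) + α * m)) • (1 : Matrix (Fin n × Fin p) (Fin n × Fin p) ℝ) -
        S⁻¹ * B * S⁻¹).PosSemidef := by
  have hsum : ∀ i, ∑ j ∈ Finset.univ.erase i, |W i j| = 1 - W i i := fun i => by
    rw [← hWrow i, ← Finset.add_sum_erase _ _ (Finset.mem_univ i), add_sub_cancel_left]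
    exact Finset.sum_congr rfl fun j _ => abs_of_nonneg (hWnonneg i j)
  have hplus : (1 - (2 : ℝ) • diagonal (fun i => W i i) + W).PosSemidef := by
    refine posSemidef_of_sum_abs_le_diag ?_ fun i => ?_
    · simp [Matrix.IsSymm, hWsymm.eq]
    · rw [Finset.sum_congr rfl (g := fun j => |W i j|), hsum]
      · simp only [Matrix.add_apply, Matrix.sub_apply, Matrix.smul_apply, one_apply_eq, diagonal_apply_eq, smul_eq_mul]
        linarith
      · intro j hj
        simp [(Finset.ne_of_mem_erase hj).symm]
  have hminus : (1 - W).PosSemidef := by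
    refine posSemidef_of_sum_abs_le_diag ?_ fun i => ?_
    · simp [Matrix.IsSymm, hWsymm.eq]
    · rw [Finset.sum_congr rfl (g := fun j => |W i j|), hsum]
      · simp
      · intro j hj
        simp [(Finset.ne_of_mem_erase hj).symm]
  have hGm : (G - m • (1 : Matrix (Fin n × Fin p) (Fin n × Fin p) ℝ)).PosSemidef := by
    convert (PosSemidef.blockDiagonal hGlb).submatrix Prod.swap using 1
    ext ⟨i, a⟩ ⟨j, b⟩
    by_cases hij : i = j <;>
      simp [hG, blockDiagonal_apply, one_apply, hij]
  have hZd' : Zd = diagonal fun q => W q.1 q.1 := by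
    ext ⟨i, a⟩ ⟨j, b⟩
    by_cases hij : i = j
    · subst hij
      by_cases hab : a = b <;> simp [hZd, hZ, one_apply, hab]
    · simp [hZd, hij]
  have hBeq : B = (1 - (2 : ℝ) • diagonal (fun i => W i i) + W) ⊗ₖ
      (1 : Matrix (Fin p) (Fin p) ℝ) := by
    rw [hB, hZd', hZ]
    ext ⟨i, a⟩ ⟨j, b⟩
    by_cases hij : i = j <;> by_cases hab : a = b <;> simp [one_apply, hij, hab]
  have hBpos : B.PosSemidef := hBeq ▸ hplus.kronecker .one
  have hδ1 : δ < 1 := hδΔ.trans_lt hΔ1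
  have hαm : 0 < α * m := mul_pos hα hm
  have hden : 0 < 2 * (1 - δ) + α * m := by linarith
  set ρ := 2 * (1 - δ) / (2 * (1 - δ) + α * m) with hρ
  have hρ0 : 0 ≤ ρ := div_nonneg (by linarith) hden.le
  have hρ1 : ρ < 1 := by rw [hρ, div_lt_one hden]; linarith
  have hρeq : ρ * (α * m) = (1 - ρ) * (2 * (1 - δ)) := by
    rw [hρ]; field_simp; ring
  have hDpos : D.PosDef := by
    have hdiag : (diagonal fun q : Fin n × Fin p => α * m + 2 * (1 - W q.1 q.1)).PosDef :=
      .diagonal fun q => by linarith [(hWdiag q.1).2]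
    convert hdiag.add_posSemidef (hGm.smul hα.le) using 1
    rw [hD, hZd']
    ext q r
    by_cases hqr : q = r
    · subst hqr
      simp
      ring
    · simp [hqr]
  have hρDB : (ρ • D - B).PosSemidef := by
    have hdiag : (diagonal fun q : Fin n × Fin p =>
        ρ * (α * m) - (1 - ρ) * (2 * (1 - W q.1 q.1))).PosSemidef := by
      refine .diagonal fun q => ?_
      have := mul_le_mul_of_nonneg_left (hWdiag q.1).1 (sub_nonneg.2 hρ1.le)
      simp only [Pi.zero_apply]
      linarith
    have hK : ((1 - W) ⊗ₖ (1 : Matrix (Fin p) (Fin p) ℝ)).PosSemidef := hminus.kronecker .one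
    convert (hK.add (hGm.smul (mul_nonneg hρ0 hα.le))).add hdiag using 1
    have hKeq : (1 - W) ⊗ₖ (1 : Matrix (Fin p) (Fin p) ℝ) = 1 - Z := by
      rw [hZ]
      ext ⟨i, a⟩ ⟨j, b⟩
      by_cases hij : i = j <;> by_cases hab : a = b <;> simp [one_apply, hij, hab]
    rw [hKeq, hD, hB, hZd']
    ext q r
    by_cases hqr : q = r
    · subst hqr
      simp
      ring
    · simp [hqr]
      ring
  refine ⟨hDpos, hρ1, fun S hS hSD => ?_⟩
  have hSinv : (S⁻¹)ᴴ = S⁻¹ := hS.inv.isHermitian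
  have hdet : IsUnit S.det := (isUnit_iff_isUnit_det S).1 hS.isUnit
  have hSDS : S⁻¹ * D * S⁻¹ = 1 := by
    rw [← hSD, nonsing_inv_mul_cancel_left _ _ hdet, mul_nonsing_inv _ hdet]
  constructor
  · simpa only [hSinv] using hBpos.conjTranspose_mul_mul_same S⁻¹
  · have := hρDB.conjTranspose_mul_mul_same S⁻¹
    rwa [hSinv, mul_sub, sub_mul, Matrix.mul_smul, Matrix.smul_mul, hSDS] at this
end

section
/- Let D ∈ ℝ^{N×N} be symmetric positive definite and B ∈ ℝ^{N×N} symmetric with 0 ⪯ D^{-1/2} B D^{-1/2} ⪯ ρ I for some ρ ∈ [0, 1). Set H := D − B and, for an integer K ≥ 0, Ĥ⁻¹ := D^{-1/2} [Σ_{k=0}^{K} (D^{-1/2} B D^{-1/2})^k] D^{-1/2}. Then for every vector g ∈ ℝ^N, ‖D^{-1/2} (I − H Ĥ⁻¹) g‖ ≤ ρ^{K+1} ‖D^{-1/2} g‖. -/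
set_option autoImplicit false

open Matrix

/-- If `0 ⪯ A ⪯ ρ I` then `A * A ⪯ ρ ^ 2 I`. -/
theorem Matrix.PosSemidef.sq_smul_one_sub_mul_self {n : Type*} [Fintype n] [DecidableEq n]
    {A : Matrix n n ℝ} {ρ : ℝ} (hρ : 0 ≤ ρ) (hA : A.PosSemidef)
    (hub : (ρ • (1 : Matrix n n ℝ) - A).PosSemidef) :
    (ρ ^ 2 • (1 : Matrix n n ℝ) - A * A).PosSemidef := by
  rcases hρ.eq_or_lt with rfl | hpos
  · have hA0 : A = 0 := by
      open scoped MatrixOrder in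
      exact le_antisymm (Matrix.le_iff.2 (by simpa using hub)) hA.nonneg
    simpa [hA0] using Matrix.PosSemidef.zero
  · have h₁ := hub.conjTranspose_mul_mul_same A
    have h₂ := hA.conjTranspose_mul_mul_same (ρ • (1 : Matrix n n ℝ) - A)
    rw [hA.isHermitian.eq] at h₁
    rw [hub.isHermitian.eq] at h₂
    have h := ((h₁.add h₂).add (hub.smul (sq_nonneg ρ))).smul (inv_nonneg.2 hρ)
    convert h using 1
    have key : A * (ρ • (1 : Matrix n n ℝ) - A) * A
        + (ρ • (1 : Matrix n n ℝ) - A) * A * (ρ • (1 : Matrix n n ℝ) - A)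
        + ρ ^ 2 • (ρ • (1 : Matrix n n ℝ) - A) = ρ • (ρ ^ 2 • (1 : Matrix n n ℝ) - A * A) := by
      simp only [mul_sub, sub_mul, smul_mul_assoc, mul_smul_comm, mul_one, one_mul, smul_sub,
        smul_smul]
      module
    rw [key, smul_smul, inv_mul_cancel₀ hpos.ne', one_smul]

/-- If `0 ⪯ A ⪯ ρ I` then `‖A x‖ ≤ ρ ‖x‖`. -/
theorem Matrix.PosSemidef.norm_toEuclideanLin_le {n : Type*} [Fintype n] [DecidableEq n]
    {A : Matrix n n ℝ} {ρ : ℝ} (hρ : 0 ≤ ρ) (hA : A.PosSemidef)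
    (hub : (ρ • (1 : Matrix n n ℝ) - A).PosSemidef) (x : EuclideanSpace ℝ n) :
    ‖Matrix.toEuclideanLin A x‖ ≤ ρ * ‖x‖ := by
  have h := (hA.sq_smul_one_sub_mul_self hρ hub).dotProduct_mulVec_nonneg x.ofLp
  have hT : Aᵀ = A := by simpa using hA.isHermitian.eq
  have hdot : x.ofLp ⬝ᵥ (A *ᵥ (A *ᵥ x.ofLp)) = (A *ᵥ x.ofLp) ⬝ᵥ (A *ᵥ x.ofLp) := by
    rw [Matrix.dotProduct_mulVec, ← Matrix.mulVec_transpose, hT]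
  simp only [star_trivial, Matrix.sub_mulVec, Matrix.smul_mulVec, Matrix.one_mulVec,
    dotProduct_sub, dotProduct_smul, ← Matrix.mulVec_mulVec, hdot, smul_eq_mul] at h
  refine abs_le_of_sq_le_sq' ?_ (by positivity) |>.2
  rw [mul_pow, EuclideanSpace.real_norm_sq_eq, EuclideanSpace.real_norm_sq_eq]
  simpa [dotProduct, ← sq, Matrix.toLpLin_apply] using h

theorem Matrix.PosSemidef.norm_toEuclideanLin_pow_le {n : Type*} [Fintype n] [DecidableEq n]
    {A : Matrix n n ℝ} {ρ : ℝ} (hρ : 0 ≤ ρ) (hA : A.PosSemidef)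
    (hub : (ρ • (1 : Matrix n n ℝ) - A).PosSemidef) (m : ℕ) (x : EuclideanSpace ℝ n) :
    ‖Matrix.toEuclideanLin (A ^ m) x‖ ≤ ρ ^ m * ‖x‖ := by
  induction m with
  | zero => simp
  | succ m ih =>
    have hmul : Matrix.toEuclideanLin (A ^ (m + 1)) x
        = Matrix.toEuclideanLin A (Matrix.toEuclideanLin (A ^ m) x) := by
      simp [Matrix.toLpLin_apply, pow_succ']
    calc ‖Matrix.toEuclideanLin (A ^ (m + 1)) x‖
        ≤ ρ * ‖Matrix.toEuclideanLin (A ^ m) x‖ := by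
          rw [hmul]; exact hA.norm_toEuclideanLin_le hρ hub _
      _ ≤ ρ * (ρ ^ m * ‖x‖) := by gcongr
      _ = ρ ^ (m + 1) * ‖x‖ := by ring

/-- Residual of the truncated Neumann series for `(S * S - B)⁻¹`. -/
theorem Matrix.inv_mul_one_sub_mul_neumann {n : Type*} [Fintype n] [DecidableEq n]
    {S : Matrix n n ℝ} (B : Matrix n n ℝ) (hS : IsUnit S.det) (m : ℕ) :
    S⁻¹ * (1 - (S * S - B) * (S⁻¹ * (∑ k ∈ Finset.range m, (S⁻¹ * B * S⁻¹) ^ k) * S⁻¹))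
      = (S⁻¹ * B * S⁻¹) ^ m * S⁻¹ := by
  have hfac : S⁻¹ * (S * S - B) * S⁻¹ = 1 - S⁻¹ * B * S⁻¹ := by
    rw [mul_sub, sub_mul, Matrix.nonsing_inv_mul_cancel_left _ _ hS, Matrix.mul_nonsing_inv _ hS]
  calc _ = S⁻¹ - (S⁻¹ * (S * S - B) * S⁻¹)
          * (∑ k ∈ Finset.range m, (S⁻¹ * B * S⁻¹) ^ k) * S⁻¹ := by noncomm_ring
    _ = _ := by rw [hfac, mul_neg_geom_sum, sub_mul, one_mul, sub_sub_cancel]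

/-- If `D` is symmetric positive definite with positive definite square root `S`,
`B` is symmetric with `0 ⪯ D^{-1/2} B D^{-1/2} ⪯ ρ I` for some `ρ ∈ [0,1)`, `H = D − B` and
`Ĥ⁻¹ = D^{-1/2} [Σ_{k=0}^{K} (D^{-1/2} B D^{-1/2})^k] D^{-1/2}`, then for every `g`,
`‖D^{-1/2}(I − H Ĥ⁻¹) g‖ ≤ ρ^{K+1} ‖D^{-1/2} g‖`. -/
theorem stmt_8 {N : ℕ} (hN : 1 ≤ N)
    (D B : Matrix (Fin N) (Fin N) ℝ) (hDsymm : D.IsSymm) (hD : D.PosDef)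
    (hBsymm : B.IsSymm) (ρ : ℝ) (hρ0 : 0 ≤ ρ) (hρ1 : ρ < 1)
    (S : Matrix (Fin N) (Fin N) ℝ) (hS : S.PosDef) (hSsq : S * S = D)
    (K : ℕ)
    (hpsd : (S⁻¹ * B * S⁻¹).PosSemidef)
    (hub : (ρ • (1 : Matrix (Fin N) (Fin N) ℝ) - S⁻¹ * B * S⁻¹).PosSemidef)
    (H Hhatinv : Matrix (Fin N) (Fin N) ℝ)
    (hH : H = D - B)
    (hHhatinv : Hhatinv = S⁻¹ * (∑ k ∈ Finset.range (K + 1), (S⁻¹ * B * S⁻¹) ^ k) * S⁻¹) :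
    ∀ g : EuclideanSpace ℝ (Fin N),
      ‖Matrix.toEuclideanLin (S⁻¹ * (1 - H * Hhatinv)) g‖ ≤
        ρ ^ (K + 1) * ‖Matrix.toEuclideanLin S⁻¹ g‖ := by
  intro g
  have hmul : Matrix.toEuclideanLin (S⁻¹ * (1 - H * Hhatinv)) g
      = Matrix.toEuclideanLin ((S⁻¹ * B * S⁻¹) ^ (K + 1)) (Matrix.toEuclideanLin S⁻¹ g) := by
    rw [hH, hHhatinv, ← hSsq,
      Matrix.inv_mul_one_sub_mul_neumann B ((Matrix.isUnit_iff_isUnit_det S).1 hS.isUnit)]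
    simp [Matrix.toLpLin_apply]
  rw [hmul]
  exact hpsd.norm_toEuclideanLin_pow_le hρ0 hub (K + 1) _
end

section
/- Suppose each local function is quadratic: f_i(x) = (1/2) xᵀ A_i x + b_iᵀ x with A_i symmetric and m I ⪯ A_i ⪯ M I (0 < m ≤ M). Then the Hessian H = I − Z + αG and the matrix D = αG + 2(I − Z_d) are constant (G being block diagonal with blocks A_i), and the NN-K iterates with unit stepsize, y_{t+1} = y_t − Ĥ⁻¹ g(y_t) where g(y) = (I − Z)y + α(Gy + b) with b = [b_1;…;b_n] and Ĥ⁻¹ = D^{-1/2}[Σ_{k=0}^{K}(D^{-1/2} B D^{-1/2})^k]D^{-1/2}, satisfy for all t ≥ 0: ‖D^{-1/2} g(y_{t+1})‖ ≤ ρ^{K+1} ‖D^{-1/2} g(y_t)‖, where ρ = 2(1−δ)/(2(1−δ)+αm). -/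
set_option autoImplicit false

open Matrix
open scoped Kronecker

lemma sum_stochastic_mul_add_sq {n : ℕ} {W : Matrix (Fin n) (Fin n) ℝ}
    (hsymm : W.IsSymm) (hrow : ∀ i, ∑ j, W i j = 1) (x : Fin n → ℝ) (s : ℝ) :
    ∑ i, ∑ j, W i j * (x i + s * x j) ^ 2
      = (1 + s ^ 2) * ∑ i, x i ^ 2 + 2 * s * ∑ i, ∑ j, x i * (W i j * x j) := by
  have hcol : ∀ j, ∑ i, W i j = 1 := fun j => by
    rw [← hrow j]
    exact Finset.sum_congr rfl fun i _ => hsymm.apply j i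
  have hr : ∑ i, ∑ j, W i j * x i ^ 2 = ∑ i, x i ^ 2 := by
    simp_rw [← Finset.sum_mul, hrow, one_mul]
  have hc : ∑ i, ∑ j, W i j * x j ^ 2 = ∑ i, x i ^ 2 := by
    rw [Finset.sum_comm]
    simp_rw [← Finset.sum_mul, hcol, one_mul]
  rw [add_mul, one_mul]
  nth_rw 1 [← hr]
  rw [← hc]
  simp_rw [Finset.mul_sum, ← Finset.sum_add_distrib]
  exact Finset.sum_congr rfl fun i _ => Finset.sum_congr rfl fun j _ => by ring

lemma sub_kronecker_of_real {l m : Type*} (A B : Matrix l l ℝ) (C : Matrix m m ℝ) :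
    (A - B) ⊗ₖ C = A ⊗ₖ C - B ⊗ₖ C := by
  ext q r
  simp [kroneckerMap_apply, sub_mul]

/-- `1 - W` is positive semidefinite for a symmetric row-stochastic matrix `W`. -/
lemma posSemidef_one_sub_of_stochastic {n : ℕ} {W : Matrix (Fin n) (Fin n) ℝ}
    (hsymm : W.IsSymm) (hnonneg : ∀ i j, 0 ≤ W i j) (hrow : ∀ i, ∑ j, W i j = 1) :
    (1 - W).PosSemidef := by
  refine PosSemidef.of_dotProduct_mulVec_nonneg ?_ fun x => ?_
  · rw [IsHermitian, conjTranspose_eq_transpose_of_trivial, transpose_sub, transpose_one, hsymm.eq]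
  have hsq : 0 ≤ ∑ i, ∑ j, W i j * (x i + -1 * x j) ^ 2 :=
    Finset.sum_nonneg fun i _ => Finset.sum_nonneg fun j _ =>
      mul_nonneg (hnonneg i j) (sq_nonneg _)
  have hexp := sum_stochastic_mul_add_sq hsymm hrow x (-1)
  have hval : star x ⬝ᵥ ((1 - W) *ᵥ x)
      = ∑ i, x i ^ 2 - ∑ i, ∑ j, x i * (W i j * x j) := by
    rw [sub_mulVec, one_mulVec, dotProduct_sub]
    simp only [dotProduct, star_trivial, mulVec, Finset.mul_sum, pow_two]
  rw [hval]
  linarith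

/-- For a symmetric row-stochastic matrix `W`, flipping the sign of the diagonal part of `W` in
`1 + W` leaves a positive semidefinite matrix. -/
lemma posSemidef_one_sub_two_diag_add_of_stochastic {n : ℕ} {W : Matrix (Fin n) (Fin n) ℝ}
    (hsymm : W.IsSymm) (hnonneg : ∀ i j, 0 ≤ W i j) (hrow : ∀ i, ∑ j, W i j = 1) :
    (1 - (2 : ℝ) • diagonal (fun i => W i i) + W).PosSemidef := by
  refine PosSemidef.of_dotProduct_mulVec_nonneg ?_ fun x => ?_
  · rw [IsHermitian, conjTranspose_eq_transpose_of_trivial, transpose_add, transpose_sub,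
      transpose_smul, diagonal_transpose, transpose_one, hsymm.eq]
  have hsq : ∑ i, W i i * (x i + x i) ^ 2 ≤ ∑ i, ∑ j, W i j * (x i + x j) ^ 2 :=
    Finset.sum_le_sum fun i _ =>
      Finset.single_le_sum (f := fun j => W i j * (x i + x j) ^ 2)
        (fun j _ => mul_nonneg (hnonneg i j) (sq_nonneg _)) (Finset.mem_univ i)
  have hdiag : ∑ i, W i i * (x i + x i) ^ 2 = 4 * ∑ i, x i * (W i i * x i) := by
    rw [Finset.mul_sum]
    exact Finset.sum_congr rfl fun i _ => by ring
  have hexp := sum_stochastic_mul_add_sq hsymm hrow x 1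
  simp only [one_mul] at hexp
  have hval : star x ⬝ᵥ ((1 - (2 : ℝ) • diagonal (fun i => W i i) + W) *ᵥ x)
      = ∑ i, x i ^ 2 - 2 * ∑ i, x i * (W i i * x i) + ∑ i, ∑ j, x i * (W i j * x j) := by
    rw [add_mulVec, sub_mulVec, smul_mulVec, one_mulVec, dotProduct_add, dotProduct_sub,
      dotProduct_smul]
    simp only [dotProduct, mulVec_diagonal, star_trivial, smul_eq_mul, pow_two]
    simp only [mulVec, dotProduct, Finset.mul_sum]
  rw [hval]
  linarith

/-- A block diagonal matrix with positive semidefinite blocks is positive semidefinite. -/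
lemma posSemidef_of_block_diagonal {ι κ : Type*} [Fintype ι] [DecidableEq ι] [Fintype κ]
    [DecidableEq κ] {A : ι → Matrix κ κ ℝ} (hA : ∀ i, (A i).PosSemidef) :
    (Matrix.of fun q r : ι × κ => if q.1 = r.1 then A q.1 q.2 r.2 else 0).PosSemidef := by
  have heq : (Matrix.of fun q r : ι × κ => if q.1 = r.1 then A q.1 q.2 r.2 else 0)
      = ∑ i, diagonal (Pi.single i (1 : ℝ)) ⊗ₖ A i := by
    ext q r
    by_cases h : q.1 = r.1 <;>
      simp [Matrix.sum_apply, kroneckerMap_apply, h, Pi.single_apply]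
  rw [heq]
  refine posSemidef_sum _ fun i _ => (PosSemidef.diagonal ?_).kronecker (hA i)
  exact Pi.single_nonneg.2 zero_le_one

/-- A matrix `T` with `0 ≤ T ≤ ρ` in the Loewner order has Euclidean operator norm at most `ρ`. -/
lemma norm_toEuclideanLin_le_of_posSemidef {ι : Type*} [Fintype ι] [DecidableEq ι]
    {T : Matrix ι ι ℝ} {ρ : ℝ} (hρ : 0 < ρ) (hT : T.PosSemidef)
    (hρT : (ρ • (1 : Matrix ι ι ℝ) - T).PosSemidef) (x : EuclideanSpace ℝ ι) :
    ‖toEuclideanLin T x‖ ≤ ρ * ‖x‖ := by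
  set P := ρ • (1 : Matrix ι ι ℝ) - T with hP
  have hTPT := hρT.mul_mul_conjTranspose_same T
  have hPTP := hT.mul_mul_conjTranspose_same P
  rw [hT.isHermitian.eq] at hTPT
  rw [hρT.isHermitian.eq] at hPTP
  have hsum := ((hρT.pow 2).smul hρ.le).add ((hTPT.add hPTP).smul zero_le_two (α := ℝ))
  have heq : ρ • P ^ 2 + (2 : ℝ) • (T * P * T + P * T * P)
      = ρ • (ρ ^ 2 • (1 : Matrix ι ι ℝ) - T * T) := by
    rw [hP]
    simp only [pow_two, sub_mul, mul_sub, smul_mul_assoc, mul_smul_comm, one_mul, mul_one,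
      mul_assoc]
    module
  rw [heq] at hsum
  have hx := hsum.dotProduct_mulVec_nonneg x.ofLp
  have hTT : x.ofLp ⬝ᵥ (T *ᵥ (T *ᵥ x.ofLp)) = (T *ᵥ x.ofLp) ⬝ᵥ (T *ᵥ x.ofLp) := by
    have hsymm : Tᵀ = T := by simpa using hT.isHermitian.eq
    rw [dotProduct_mulVec, ← mulVec_transpose, hsymm]
  rw [smul_mulVec, dotProduct_smul, smul_eq_mul, star_trivial, sub_mulVec, smul_mulVec,
    one_mulVec, ← mulVec_mulVec, dotProduct_sub, dotProduct_smul, smul_eq_mul, hTT] at hx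
  have hx' := nonneg_of_mul_nonneg_right hx hρ
  refine le_of_sq_le_sq ?_ (by positivity)
  rw [mul_pow, EuclideanSpace.real_norm_sq_eq, EuclideanSpace.real_norm_sq_eq]
  simp only [toLpLin_apply]
  simp only [dotProduct, ← pow_two] at hx'
  linarith

lemma norm_toEuclideanLin_pow_le {ι : Type*} [Fintype ι] [DecidableEq ι]
    {T : Matrix ι ι ℝ} {ρ : ℝ} (hρ : 0 ≤ ρ)
    (hT : ∀ x, ‖toEuclideanLin T x‖ ≤ ρ * ‖x‖) (k : ℕ) (x : EuclideanSpace ℝ ι) :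
    ‖toEuclideanLin (T ^ k) x‖ ≤ ρ ^ k * ‖x‖ := by
  induction k with
  | zero => simp
  | succ k ih =>
    have h : toEuclideanLin (T ^ (k + 1)) x = toEuclideanLin T (toEuclideanLin (T ^ k) x) := by
      simp [toLpLin_apply, pow_succ']
    rw [h, pow_succ', mul_assoc]
    exact (hT _).trans (mul_le_mul_of_nonneg_left ih hρ)

/-- For quadratic local functions `fᵢ(x) = ½xᵀAᵢx + bᵢᵀx` with `mI ⪯ Aᵢ ⪯ MI`,
the NN-K iterates with unit stepsize `y_{t+1} = y_t − Ĥ⁻¹ g(y_t)`, where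
`g(y) = (I−Z)y + α(Gy + b)` and `Ĥ⁻¹ = D^{-1/2}[Σ_{k=0}^{K}(D^{-1/2}BD^{-1/2})^k]D^{-1/2}`,
satisfy `‖D^{-1/2} g(y_{t+1})‖ ≤ ρ^{K+1} ‖D^{-1/2} g(y_t)‖` with
`ρ = 2(1−δ)/(2(1−δ)+αm)`. -/
theorem stmt_13 {n p : ℕ} (hn : 1 ≤ n) (hp : 1 ≤ p) (K : ℕ)
    (δ Δ m M α : ℝ) (hδ0 : 0 ≤ δ) (hδΔ : δ ≤ Δ) (hΔ1 : Δ < 1)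
    (hm : 0 < m) (hmM : m ≤ M) (hα : 0 < α)
    (W : Matrix (Fin n) (Fin n) ℝ)
    (hWsymm : W.IsSymm)
    (hWnonneg : ∀ i j, 0 ≤ W i j)
    (hWrow : ∀ i, ∑ j, W i j = 1)
    (hWdiag : ∀ i, δ ≤ W i i ∧ W i i ≤ Δ)
    (A : Fin n → Matrix (Fin p) (Fin p) ℝ)
    (bv : Fin n → EuclideanSpace ℝ (Fin p))
    (hAsymm : ∀ i, (A i).IsSymm)
    (hAlb : ∀ i, (A i - m • (1 : Matrix (Fin p) (Fin p) ℝ)).PosSemidef)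
    (hAub : ∀ i, (M • (1 : Matrix (Fin p) (Fin p) ℝ) - A i).PosSemidef)
    (Z Zd B G D H : Matrix (Fin n × Fin p) (Fin n × Fin p) ℝ)
    (hZ : Z = W ⊗ₖ (1 : Matrix (Fin p) (Fin p) ℝ))
    (hZd : Zd = Matrix.of fun q r => if q.1 = r.1 then Z q r else 0)
    (hB : B = 1 - (2 : ℝ) • Zd + Z)
    (hG : G = Matrix.of fun q r => if q.1 = r.1 then A q.1 q.2 r.2 else 0)
    (hD : D = α • G + (2 : ℝ) • (1 - Zd))
    (hH : H = 1 - Z + α • G)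
    (b : EuclideanSpace ℝ (Fin n × Fin p))
    (hb : ∀ q : Fin n × Fin p, b q = bv q.1 q.2)
    (g : EuclideanSpace ℝ (Fin n × Fin p) → EuclideanSpace ℝ (Fin n × Fin p))
    (hg : ∀ y, g y = Matrix.toEuclideanLin (1 - Z) y +
        α • (Matrix.toEuclideanLin G y + b))
    (S Hhatinv : Matrix (Fin n × Fin p) (Fin n × Fin p) ℝ)
    (hS : S.PosDef) (hSsq : S * S = D)
    (hHhatinv : Hhatinv = S⁻¹ * (∑ k ∈ Finset.range (K + 1), (S⁻¹ * B * S⁻¹) ^ k) * S⁻¹)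
    (y : ℕ → EuclideanSpace ℝ (Fin n × Fin p))
    (hupdate : ∀ t, y (t + 1) = y t - Matrix.toEuclideanLin Hhatinv (g (y t)))
    (ρ : ℝ) (hρ : ρ = 2 * (1 - δ) / (2 * (1 - δ) + α * m)) :
    ∀ t : ℕ,
      ‖Matrix.toEuclideanLin S⁻¹ (g (y (t + 1)))‖ ≤
        ρ ^ (K + 1) * ‖Matrix.toEuclideanLin S⁻¹ (g (y t))‖ := by
  have hδ1 : 0 < 1 - δ := by linarith
  have hαm : 0 < α * m := mul_pos hα hm
  have hden : 0 < 2 * (1 - δ) + α * m := by linarith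
  have hρpos : 0 < ρ := by rw [hρ]; positivity
  have hρden : ρ * (2 * (1 - δ) + α * m) = 2 * (1 - δ) := by
    rw [hρ]; field_simp
  have hρ1 : ρ ≤ 1 := by rw [hρ, div_le_one hden]; linarith
  have hZdkron : Zd = diagonal (fun i => W i i) ⊗ₖ (1 : Matrix (Fin p) (Fin p) ℝ) := by
    rw [hZd, hZ]
    ext q r
    by_cases h : q.1 = r.1 <;> simp [kroneckerMap_apply, h]
  have hZddiag : Zd = diagonal (fun q => W q.1 q.1) := by
    rw [hZdkron, ← diagonal_one, diagonal_kronecker_diagonal]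
    simp
  have hBpsd : B.PosSemidef := by
    have h := (posSemidef_one_sub_two_diag_add_of_stochastic hWsymm hWnonneg hWrow).kronecker
      (PosSemidef.one (n := Fin p) (R := ℝ))
    rwa [add_kronecker, sub_kronecker_of_real, smul_kronecker, one_kronecker_one, ← hZdkron, ← hZ,
      ← hB] at h
  have hIZ : (1 - Z).PosSemidef := by
    have h := (posSemidef_one_sub_of_stochastic hWsymm hWnonneg hWrow).kronecker
      (PosSemidef.one (n := Fin p) (R := ℝ))
    rwa [sub_kronecker_of_real, one_kronecker_one, ← hZ] at h
  have hGm : (G - m • (1 : Matrix (Fin n × Fin p) (Fin n × Fin p) ℝ)).PosSemidef := by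
    have h := posSemidef_of_block_diagonal hAlb
    convert h using 1
    rw [hG]
    ext q r
    by_cases h : q.1 = r.1 <;> simp [one_apply, Prod.ext_iff, h]
  have hdiag : (diagonal (fun q : Fin n × Fin p =>
      ρ * α * m - 2 * (1 - ρ) * (1 - W q.1 q.1))).PosSemidef := by
    refine PosSemidef.diagonal fun q => ?_
    have h := mul_le_mul_of_nonneg_left (sub_le_sub_left (hWdiag q.1).1 1) (sub_nonneg.2 hρ1)
    simp only [Pi.zero_apply]
    linarith
  have hDB : (ρ • D - B).PosSemidef := by
    have h := ((hGm.smul (mul_pos hρpos hα).le).add hIZ).add hdiag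
    convert h using 1
    rw [hD, hB, hZddiag]
    ext q r
    by_cases h : q = r
    · subst h
      simp
      ring
    · simp [h]
      ring
  have hSdet : IsUnit S.det := (isUnit_iff_isUnit_det S).1 hS.isUnit
  have hSl : S⁻¹ * S = 1 := nonsing_inv_mul S hSdet
  have hSr : S * S⁻¹ = 1 := mul_nonsing_inv S hSdet
  have hSinv : (S⁻¹)ᴴ = S⁻¹ := hS.inv.isHermitian.eq
  set T := S⁻¹ * B * S⁻¹ with hTdef
  have hT : T.PosSemidef := by
    have h := hBpsd.mul_mul_conjTranspose_same S⁻¹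
    rwa [hSinv] at h
  have hρT : (ρ • (1 : Matrix (Fin n × Fin p) (Fin n × Fin p) ℝ) - T).PosSemidef := by
    have h := hDB.mul_mul_conjTranspose_same S⁻¹
    rw [hSinv, mul_sub, sub_mul, mul_smul_comm, smul_mul_assoc, ← hSsq, ← mul_assoc S⁻¹ S S, hSl,
      one_mul, hSr] at h
    exact h
  have hHDB : H = D - B := by
    rw [hH, hD, hB]
    module
  have hSTS : S * T * S = B := by
    calc S * T * S = (S * S⁻¹) * B * (S⁻¹ * S) := by simp only [hTdef, mul_assoc]
      _ = B := by rw [hSr, hSl, one_mul, mul_one]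
  have hHfac : H = S * (1 - T) * S := by
    rw [hHDB, mul_sub, sub_mul, mul_one, hSsq, hSTS]
  have hcontr : S⁻¹ * (1 - H * Hhatinv) = T ^ (K + 1) * S⁻¹ := by
    have h : H * Hhatinv = S * (1 - T ^ (K + 1)) * S⁻¹ := by
      rw [← mul_neg_geom_sum T (K + 1), hHhatinv, hHfac]
      calc _ = S * (1 - T) * (S * S⁻¹) * (∑ k ∈ Finset.range (K + 1), T ^ k) * S⁻¹ := by
            simp only [mul_assoc]
        _ = _ := by rw [hSr, mul_one]; simp only [mul_assoc]
    rw [h, mul_sub, mul_one, ← mul_assoc, ← mul_assoc, hSl, one_mul, sub_mul, one_mul,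
      sub_sub_cancel]
  intro t
  have hstep : g (y (t + 1)) = g (y t) - toEuclideanLin H (toEuclideanLin Hhatinv (g (y t))) := by
    rw [hupdate t]
    generalize toEuclideanLin Hhatinv (g (y t)) = v
    rw [hg, hg, hH]
    simp only [map_add, map_sub, map_smul, LinearMap.add_apply, LinearMap.sub_apply,
      LinearMap.smul_apply]
    module
  have hres : toEuclideanLin S⁻¹ (g (y (t + 1)))
      = toEuclideanLin (T ^ (K + 1)) (toEuclideanLin S⁻¹ (g (y t))) := by
    rw [hstep]
    have h := congrArg (fun N => WithLp.toLp 2 (N *ᵥ (g (y t)).ofLp)) hcontr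
    simpa only [toLpLin_apply, mul_sub, mul_one, sub_mulVec, mulVec_sub, mulVec_mulVec,
      WithLp.ofLp_sub] using h
  rw [hres]
  exact norm_toEuclideanLin_pow_le hρpos.le
    (norm_toEuclideanLin_le_of_posSemidef hρpos hT hρT) (K + 1) _
end
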